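/- Let $r, C$ be integers with $1 \leq r \leq C < 2r - 1$, and set $t = C - r + 1$ (so that $1 \leq t < r$). Then $\frac{t}{C} - \frac{1}{r\binom{C}{t}} \sum_{i=1}^{t-1} (t-i)\binom{r}{t-i+1}\binom{C-r}{i-1} = \frac{1}{r}$ as an equality of rational numbers. -/

import Mathlib

/-- A weighted Vandermonde convolution. -/
theorem sum_range_sub_mul_choose_mul_choose (s m : ℕ) :
    ∑ j ∈ Finset.range (m + 1),
        ((m : ℚ) - j) * ((s + 1).choose (m - j + 1) : ℚ) * (m.choose j : ℚ) =
      (s + 1) * ((m + s).choose m : ℚ) - ((m + (s + 1)).choose (m + 1) : ℚ) := by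
  rw [Nat.add_choose_eq m s m, Nat.add_choose_eq m (s + 1) (m + 1),
    Finset.Nat.sum_antidiagonal_eq_sum_range_succ_mk,
    Finset.Nat.sum_antidiagonal_eq_sum_range_succ_mk, Finset.sum_range_succ _ (m + 1)]
  simp only [Nat.choose_succ_self, zero_mul, add_zero]
  push_cast
  rw [Finset.mul_sum, ← Finset.sum_sub_distrib]
  refine Finset.sum_congr rfl fun j hj => ?_
  have hjm : j ≤ m := Nat.lt_succ_iff.mp (Finset.mem_range.mp hj)
  have absorb : ((s : ℚ) + 1) * (s.choose (m - j) : ℚ) =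
      ((s + 1).choose (m - j + 1) : ℚ) * ((m : ℚ) - j + 1) := by
    rw [← Nat.cast_sub hjm]
    exact_mod_cast Nat.add_one_mul_choose_eq s (m - j)
  rw [Nat.sub_add_comm hjm]
  linear_combination -(m.choose j : ℚ) * absorb

/-- For `1 ≤ r ≤ C < 2r - 1` and `t = C - r + 1`:
`t/C - (1/(r C(C,t))) ∑_{i=1}^{t-1} (t-i) C(r,t-i+1) C(C-r,i-1) = 1/r`
as rational numbers. -/
theorem memory_at_t_eq_C_sub_r_add_one_lt_case (r C t : ℕ) (hr : 1 ≤ r) (hrC : r ≤ C)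
    (hC : C < 2 * r - 1) (ht : t = C - r + 1) :
    (t : ℚ) / (C : ℚ) -
        (1 / ((r : ℚ) * (C.choose t : ℚ))) *
          ∑ i ∈ Finset.Icc 1 (t - 1),
            ((t : ℚ) - (i : ℚ)) * (r.choose (t - i + 1) : ℚ) * ((C - r).choose (i - 1) : ℚ)
      = 1 / (r : ℚ) := by
  obtain ⟨s, rfl⟩ := Nat.exists_eq_add_of_le' hr
  obtain ⟨m, rfl⟩ := Nat.exists_eq_add_of_le' hrC
  rw [Nat.add_sub_cancel] at ht ⊢
  subst ht
  have hsum : ∑ i ∈ Finset.Icc 1 (m + 1 - 1),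
      (((m + 1 : ℕ) : ℚ) - (i : ℚ)) * ((s + 1).choose (m + 1 - i + 1) : ℚ) *
        (m.choose (i - 1) : ℚ) =
      (s + 1) * ((m + s).choose m : ℚ) - ((m + (s + 1)).choose (m + 1) : ℚ) := by
    rw [← sum_range_sub_mul_choose_mul_choose, Finset.sum_range_succ, sub_self, zero_mul,
      zero_mul, add_zero, Nat.add_sub_cancel, ← Finset.Ico_add_one_right_eq_Icc,
      Finset.sum_Ico_eq_sum_range, Nat.add_sub_cancel]
    refine Finset.sum_congr rfl fun j _ => ?_
    rw [Nat.add_sub_cancel_left, show m + 1 - (1 + j) = m - j by omega]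
    push_cast
    ring
  have absorb : ((m : ℚ) + (s + 1)) * ((m + s).choose m : ℚ) =
      ((m + (s + 1)).choose (m + 1) : ℚ) * ((m : ℚ) + 1) := by
    exact_mod_cast Nat.add_one_mul_choose_eq (m + s) m
  have hchoose : ((m + (s + 1)).choose (m + 1) : ℚ) ≠ 0 :=
    Nat.cast_ne_zero.mpr (Nat.choose_pos (by omega)).ne'
  have hs : (s : ℚ) + 1 ≠ 0 := by positivity
  have hms : (m : ℚ) + (s + 1) ≠ 0 := by positivity
  rw [hsum]
  push_cast
  field_simp
  linear_combination -((s : ℚ) + 1) * absorb
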